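/- Let M be a set endowed with a chronology ≪ admitting a countable chronologically dense subset D (i.e., whenever x ≪ y there is d ∈ D with x ≪ d ≪ y), and let M̄ be an admissible completion as a point set of (M,≪). Then the countable family {I⁺((I⁻(d),I⁺(d))) : d ∈ D} ∪ {I⁻((I⁻(d),I⁺(d))) : d ∈ D} is a subbasis of CEAT; in particular, CEAT is second countable. -/

import Mathlib

open Filter Set Topology

variable {M : Type*}

/-- The chronological past `I⁻(p)` of a point. -/
def IPast (r : M → M → Prop) (p : M) : Set M := {q | r q p}

/-- The chronological future `I⁺(p)` of a point. -/
def IFut (r : M → M → Prop) (p : M) : Set M := {q | r p q}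

/-- The chronological past `I⁻[S]` of a set. -/
def IPastS (r : M → M → Prop) (S : Set M) : Set M := ⋃ s ∈ S, IPast r s

/-- The chronological future `I⁺[S]` of a set. -/
def IFutS (r : M → M → Prop) (S : Set M) : Set M := ⋃ s ∈ S, IFut r s

/-- A past set: `P = I⁻[P]`. -/
def IsPastSet (r : M → M → Prop) (P : Set M) : Prop := P = IPastS r P

/-- A future set: `F = I⁺[F]`. -/
def IsFutSet (r : M → M → Prop) (F : Set M) : Prop := F = IFutS r F

/-- An indecomposable past set (IP). -/
def IsIP (r : M → M → Prop) (P : Set M) : Prop :=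
  P.Nonempty ∧ IsPastSet r P ∧
    ¬∃ P₁ P₂ : Set M, IsPastSet r P₁ ∧ IsPastSet r P₂ ∧ P₁ ⊂ P ∧ P₂ ⊂ P ∧ P = P₁ ∪ P₂

/-- An indecomposable future set (IF). -/
def IsIF (r : M → M → Prop) (F : Set M) : Prop :=
  F.Nonempty ∧ IsFutSet r F ∧
    ¬∃ F₁ F₂ : Set M, IsFutSet r F₁ ∧ IsFutSet r F₂ ∧ F₁ ⊂ F ∧ F₂ ⊂ F ∧ F = F₁ ∪ F₂

/-- A terminal IP (TIP): an IP which is not of the form `I⁻(p)`. -/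
def IsTIP (r : M → M → Prop) (P : Set M) : Prop := IsIP r P ∧ ∀ p : M, P ≠ IPast r p

/-- A terminal IF (TIF). -/
def IsTIF (r : M → M → Prop) (F : Set M) : Prop := IsIF r F ∧ ∀ p : M, F ≠ IFut r p

/-- The common future `↑P`. -/
def commonFut (r : M → M → Prop) (P : Set M) : Set M := IFutS r {q | ∀ p ∈ P, r p q}

/-- The common past `↓F`. -/
def commonPast (r : M → M → Prop) (F : Set M) : Set M := IPastS r {q | ∀ p ∈ F, r q p}

/-- `P` is a maximal IP contained in `S`. -/
def MaxIPIn (r : M → M → Prop) (P S : Set M) : Prop :=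
  IsIP r P ∧ P ⊆ S ∧ ∀ P', IsIP r P' → P' ⊆ S → P ⊆ P' → P = P'

/-- `F` is a maximal IF contained in `S`. -/
def MaxIFIn (r : M → M → Prop) (F S : Set M) : Prop :=
  IsIF r F ∧ F ⊆ S ∧ ∀ F', IsIF r F' → F' ⊆ S → F ⊆ F' → F = F'

/-- The Szabados relation between (nonempty) indecomposable sets: `F` is a maximal IF
contained in `↑P` and `P` is a maximal IP contained in `↓F`. -/
def SRelNE (r : M → M → Prop) (P F : Set M) : Prop :=
  MaxIFIn r F (commonFut r P) ∧ MaxIPIn r P (commonPast r F)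

/-- The full S-relation, allowing one empty component. -/
def SRel (r : M → M → Prop) (P F : Set M) : Prop :=
  SRelNE r P F ∨
    (F = ∅ ∧ IsIP r P ∧ ∀ F', IsIF r F' → ¬SRelNE r P F') ∨
    (P = ∅ ∧ IsIF r F ∧ ∀ P', IsIP r P' → ¬SRelNE r P' F)

/-- The embedding `i(p) = (I⁻(p), I⁺(p))`. -/
def chrEmb (r : M → M → Prop) (p : M) : Set M × Set M := (IPast r p, IFut r p)

/-- The image `i(M)` inside the set of pairs. -/
def imgM (r : M → M → Prop) : Set (Set M × Set M) := Set.range (chrEmb r)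

/-- An admissible completion as a point set. -/
structure IsAdmissibleCompletion (r : M → M → Prop) (Mb : Set (Set M × Set M)) : Prop where
  mem_point : ∀ p : M, chrEmb r p ∈ Mb
  complete_TIP : ∀ P : Set M, IsTIP r P → ∃ x ∈ Mb \ imgM r, x.1 = P
  complete_TIF : ∀ F : Set M, IsTIF r F → ∃ x ∈ Mb \ imgM r, x.2 = F
  srel : ∀ x ∈ Mb, SRel r x.1 x.2

/-- The extended chronological relation `(P,F) ≪̄ (P',F') ↔ F ∩ P' ≠ ∅`. -/
def extChron (x y : Set M × Set M) : Prop := (x.2 ∩ y.1).Nonempty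

/-- A chronology: a transitive and anti-reflexive binary relation. -/
def IsChronology (r : M → M → Prop) : Prop := Transitive r ∧ Irreflexive r

/-- A chronological set: a chronology with no isolates which is chronologically separable. -/
def IsChronologicalSet (r : M → M → Prop) : Prop :=
  IsChronology r ∧ (∀ x, ∃ y, r x y ∨ r y x) ∧
    ∃ S : Set M, S.Countable ∧ ∀ x y, r x y → ∃ s ∈ S, r x s ∧ r s y
/-- The chronological future of a point of the completion, inside the completion,
with respect to the extended chronological relation. -/
def futIn (Mb : Set (Set M × Set M)) (x : ↥Mb) : Set ↥Mb :=
  {y | extChron (x : Set M × Set M) (y : Set M × Set M)}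

/-- The chronological past of a point of the completion, inside the completion. -/
def pastIn (Mb : Set (Set M × Set M)) (x : ↥Mb) : Set ↥Mb :=
  {y | extChron (y : Set M × Set M) (x : Set M × Set M)}

/-- CEAT: the coarsest topology on the completion in which all the sets `I⁺((P,F))`
and `I⁻((P,F))` are open. -/
def CEAT (Mb : Set (Set M × Set M)) : TopologicalSpace ↥Mb :=
  TopologicalSpace.generateFrom
    ({S | ∃ x : ↥Mb, S = futIn Mb x} ∪ {S | ∃ x : ↥Mb, S = pastIn Mb x})

/-- The set-theoretic inferior limit of a sequence of sets. -/
def setLI (A : ℕ → Set M) : Set M := {x | ∀ᶠ n in Filter.atTop, x ∈ A n}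

/-- The set-theoretic superior limit of a sequence of sets. -/
def setLS (A : ℕ → Set M) : Set M := {x | ∃ᶠ n in Filter.atTop, x ∈ A n}

/-- The chronological limit operator (on pairs). -/
def chrLim (r : M → M → Prop) (σ : ℕ → Set M × Set M) (x : Set M × Set M) : Prop :=
  (x.1 ≠ ∅ → x.1 ⊆ setLI (fun n => (σ n).1) ∧ MaxIPIn r x.1 (setLS fun n => (σ n).1)) ∧
  (x.2 ≠ ∅ → x.2 ⊆ setLI (fun n => (σ n).2) ∧ MaxIFIn r x.2 (setLS fun n => (σ n).2))

/-- The topology derived from a limit operator: closed sets are those containing all the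
`L`-limits of their sequences. -/
def derivedTop {X : Type*} (L : (ℕ → X) → Set X)
    (hL : ∀ (σ : ℕ → X) (φ : ℕ → ℕ), StrictMono φ → L σ ⊆ L (σ ∘ φ)) :
    TopologicalSpace X where
  IsOpen U := ∀ σ : ℕ → X, (∀ n, σ n ∈ Uᶜ) → L σ ⊆ Uᶜ
  isOpen_univ := by
    intro σ h
    simpa using h 0
  isOpen_inter := by
    intro U V hU hV σ hσ x hx
    have h : ∀ n, σ n ∈ Uᶜ ∨ σ n ∈ Vᶜ := by
      intro n
      have h' := hσ n
      rw [Set.compl_inter] at h'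
      exact h'
    have hfreq : (∃ᶠ n in Filter.atTop, σ n ∈ Uᶜ) ∨ ∃ᶠ n in Filter.atTop, σ n ∈ Vᶜ :=
      Filter.frequently_or_distrib.mp (Filter.Frequently.of_forall h)
    rw [Set.compl_inter]
    rcases hfreq with hf | hf
    · obtain ⟨φ, hφ, hmem⟩ := Filter.extraction_of_frequently_atTop hf
      exact Or.inl (hU (σ ∘ φ) hmem (hL σ φ hφ hx))
    · obtain ⟨φ, hφ, hmem⟩ := Filter.extraction_of_frequently_atTop hf
      exact Or.inr (hV (σ ∘ φ) hmem (hL σ φ hφ hx))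
  isOpen_sUnion := by
    intro S hS σ hσ x hx
    intro hmem
    rcases hmem with ⟨U, hU, hxU⟩
    exact hS U hU σ (fun n h => hσ n ⟨U, hU, h⟩) hx hxU

lemma setLI_subseq {A : ℕ → Set M} {φ : ℕ → ℕ} (hφ : StrictMono φ) :
    setLI A ⊆ setLI fun n => A (φ n) :=
  fun _ hx => hφ.tendsto_atTop.eventually hx

lemma setLS_subseq {A : ℕ → Set M} {φ : ℕ → ℕ} (hφ : StrictMono φ) :
    (setLS fun n => A (φ n)) ⊆ setLS A :=
  fun _ hx => hφ.tendsto_atTop.frequently hx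

/-- The chronological limit operator on the completion. -/
def chrL (r : M → M → Prop) (Mb : Set (Set M × Set M)) (σ : ℕ → ↥Mb) : Set ↥Mb :=
  {x | chrLim r (fun n => ((σ n : Set M × Set M))) (x : Set M × Set M)}

lemma chrL_subseq (r : M → M → Prop) (Mb : Set (Set M × Set M)) :
    ∀ (σ : ℕ → ↥Mb) (φ : ℕ → ℕ), StrictMono φ → chrL r Mb σ ⊆ chrL r Mb (σ ∘ φ) := by
  intro σ φ hφ x hx
  obtain ⟨h1, h2⟩ := hx
  constructor
  · intro hne
    obtain ⟨hli, hmax⟩ := h1 hne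
    exact ⟨fun y hy => setLI_subseq hφ (hli hy), hmax.1,
      fun y hy => Filter.Eventually.frequently (setLI_subseq hφ (hli hy)),
      fun P' hP' hP'sub hsub => hmax.2.2 P' hP' (fun y hy => setLS_subseq hφ (hP'sub hy)) hsub⟩
  · intro hne
    obtain ⟨hli, hmax⟩ := h2 hne
    exact ⟨fun y hy => setLI_subseq hφ (hli hy), hmax.1,
      fun y hy => Filter.Eventually.frequently (setLI_subseq hφ (hli hy)),
      fun F' hF' hF'sub hsub => hmax.2.2 F' hF' (fun y hy => setLS_subseq hφ (hF'sub hy)) hsub⟩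

/-- The chronological topology on the completion. -/
def chrTop (r : M → M → Prop) (Mb : Set (Set M × Set M)) : TopologicalSpace ↥Mb :=
  derivedTop (chrL r Mb) (chrL_subseq r Mb)

/-- Admissibility condition (A1): chronological futures and pasts are open. -/
def CondA1 (Mb : Set (Set M × Set M)) (τ : TopologicalSpace ↥Mb) : Prop :=
  ∀ x : ↥Mb, IsOpen[τ] (futIn Mb x) ∧ IsOpen[τ] (pastIn Mb x)

/-- Admissibility condition (A2). -/
def CondA2 (Mb : Set (Set M × Set M)) (τ : TopologicalSpace ↥Mb) : Prop :=
  (∀ (σ : ℕ → ↥Mb) (x : ↥Mb), Filter.Tendsto σ Filter.atTop (@nhds _ τ x) →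
      (x : Set M × Set M).2 = ∅ →
      ∀ y : ↥Mb, (x : Set M × Set M).1 ⊆ (y : Set M × Set M).1 →
        (y : Set M × Set M).1 ⊆ setLI (fun n => ((σ n : Set M × Set M)).1) → y = x) ∧
  (∀ (σ : ℕ → ↥Mb) (x : ↥Mb), Filter.Tendsto σ Filter.atTop (@nhds _ τ x) →
      (x : Set M × Set M).1 = ∅ →
      ∀ y : ↥Mb, (x : Set M × Set M).2 ⊆ (y : Set M × Set M).2 →
        (y : Set M × Set M).2 ⊆ setLI (fun n => ((σ n : Set M × Set M)).2) → y = x)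

/-- Admissibility condition (A3): maximal coarseness among (A1)∧(A2) topologies. -/
def CondA3 (Mb : Set (Set M × Set M)) (τ : TopologicalSpace ↥Mb) : Prop :=
  ∀ τ' : TopologicalSpace ↥Mb, CondA1 Mb τ' → CondA2 Mb τ' → ¬(τ < τ')

lemma IsPastSet.mem_iff {r : M → M → Prop} {P : Set M} (hP : IsPastSet r P) {q : M} :
    q ∈ P ↔ ∃ p ∈ P, r q p := by
  have h := Set.ext_iff.mp (show P = IPastS r P from hP) q
  simpa [IPastS, IPast] using h

lemma IsFutSet.mem_iff {r : M → M → Prop} {F : Set M} (hF : IsFutSet r F) {q : M} :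
    q ∈ F ↔ ∃ p ∈ F, r p q := by
  have h := Set.ext_iff.mp (show F = IFutS r F from hF) q
  simpa [IFutS, IFut] using h

lemma SRel.isPastSet {r : M → M → Prop} {P F : Set M} (h : SRel r P F) : IsPastSet r P := by
  rcases h with h | ⟨-, h, -⟩ | ⟨rfl, -, -⟩
  · exact h.2.1.2.1
  · exact h.2.1
  · simp [IsPastSet, IPastS]

lemma SRel.isFutSet {r : M → M → Prop} {P F : Set M} (h : SRel r P F) : IsFutSet r F := by
  rcases h with h | ⟨rfl, -, -⟩ | ⟨-, h, -⟩
  · exact h.1.1.2.1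
  · simp [IsFutSet, IFutS]
  · exact h.2.1

/-- A future set meets `P` iff it contains a point of the dense set `D` whose future meets `P`. -/
lemma IsFutSet.inter_nonempty_iff {r : M → M → Prop} {D F : Set M} (hF : IsFutSet r F)
    (hD : ∀ x y : M, r x y → ∃ d ∈ D, r x d ∧ r d y) (P : Set M) :
    (F ∩ P).Nonempty ↔ ∃ d ∈ D ∩ F, (IFut r d ∩ P).Nonempty := by
  constructor
  · rintro ⟨q, hqF, hqP⟩
    obtain ⟨p, hp, hpq⟩ := hF.mem_iff.mp hqF
    obtain ⟨d, hd, hpd, hdq⟩ := hD p q hpq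
    exact ⟨d, ⟨hd, hF.mem_iff.mpr ⟨p, hp, hpd⟩⟩, q, hdq, hqP⟩
  · rintro ⟨d, ⟨-, hd⟩, q, hdq, hqP⟩
    exact ⟨q, hF.mem_iff.mpr ⟨d, hd, hdq⟩, hqP⟩

/-- A past set meets `F` iff it contains a point of the dense set `D` whose past meets `F`. -/
lemma IsPastSet.inter_nonempty_iff {r : M → M → Prop} {D P : Set M} (hP : IsPastSet r P)
    (hD : ∀ x y : M, r x y → ∃ d ∈ D, r x d ∧ r d y) (F : Set M) :
    (F ∩ P).Nonempty ↔ ∃ d ∈ D ∩ P, (F ∩ IPast r d).Nonempty := by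
  constructor
  · rintro ⟨q, hqF, hqP⟩
    obtain ⟨p, hp, hqp⟩ := hP.mem_iff.mp hqP
    obtain ⟨d, hd, hqd, hdp⟩ := hD q p hqp
    exact ⟨d, ⟨hd, hP.mem_iff.mpr ⟨p, hp, hdp⟩⟩, q, hqF, hqd⟩
  · rintro ⟨d, ⟨-, hd⟩, q, hqF, hqd⟩
    exact ⟨q, hqF, hP.mem_iff.mpr ⟨d, hd, hqd⟩⟩

lemma futIn_eq_biUnion {r : M → M → Prop} {D : Set M}
    (hD : ∀ x y : M, r x y → ∃ d ∈ D, r x d ∧ r d y)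
    {Mb : Set (Set M × Set M)} (hMb : IsAdmissibleCompletion r Mb) (x : ↥Mb) :
    futIn Mb x = ⋃ d ∈ D ∩ x.1.2, futIn Mb ⟨chrEmb r d, hMb.mem_point d⟩ := by
  ext y
  simp only [Set.mem_iUnion, exists_prop]
  exact (hMb.srel _ x.2).isFutSet.inter_nonempty_iff hD y.1.1

lemma pastIn_eq_biUnion {r : M → M → Prop} {D : Set M}
    (hD : ∀ x y : M, r x y → ∃ d ∈ D, r x d ∧ r d y)
    {Mb : Set (Set M × Set M)} (hMb : IsAdmissibleCompletion r Mb) (x : ↥Mb) :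
    pastIn Mb x = ⋃ d ∈ D ∩ x.1.1, pastIn Mb ⟨chrEmb r d, hMb.mem_point d⟩ := by
  ext y
  simp only [Set.mem_iUnion, exists_prop]
  exact (hMb.srel _ x.2).isPastSet.inter_nonempty_iff hD y.1.2

/-- **Proposition.** If `(M,≪)` admits a countable chronologically dense subset `D`, then for
any admissible completion as a point set `M̄`, the countable family
`{I⁺(i(d)) : d ∈ D} ∪ {I⁻(i(d)) : d ∈ D}` is a subbasis of CEAT; in particular CEAT is
second countable. -/
theorem CEAT_secondCountable
    (r : M → M → Prop) (hr : IsChronology r)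
    (D : Set M) (hDcount : D.Countable)
    (hDdense : ∀ x y : M, r x y → ∃ d ∈ D, r x d ∧ r d y)
    (Mb : Set (Set M × Set M)) (hMb : IsAdmissibleCompletion r Mb) :
    CEAT Mb = TopologicalSpace.generateFrom
      ({S : Set ↥Mb | ∃ d ∈ D, S = futIn Mb ⟨chrEmb r d, hMb.mem_point d⟩} ∪
       {S : Set ↥Mb | ∃ d ∈ D, S = pastIn Mb ⟨chrEmb r d, hMb.mem_point d⟩}) ∧
    @SecondCountableTopology ↥Mb (CEAT Mb) := by
  have h : CEAT Mb = TopologicalSpace.generateFrom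
      ({S : Set ↥Mb | ∃ d ∈ D, S = futIn Mb ⟨chrEmb r d, hMb.mem_point d⟩} ∪
       {S : Set ↥Mb | ∃ d ∈ D, S = pastIn Mb ⟨chrEmb r d, hMb.mem_point d⟩}) := by
    apply le_antisymm
    · apply TopologicalSpace.generateFrom_anti
      rintro S (⟨d, -, rfl⟩ | ⟨d, -, rfl⟩)
      · exact Or.inl ⟨_, rfl⟩
      · exact Or.inr ⟨_, rfl⟩
    · apply le_generateFrom
      rintro S (⟨x, rfl⟩ | ⟨x, rfl⟩)
      · rw [futIn_eq_biUnion hDdense hMb x]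
        exact @isOpen_biUnion _ _ (_) _ _ fun d hd =>
          TopologicalSpace.isOpen_generateFrom_of_mem (Or.inl ⟨d, hd.1, rfl⟩)
      · rw [pastIn_eq_biUnion hDdense hMb x]
        exact @isOpen_biUnion _ _ (_) _ _ fun d hd =>
          TopologicalSpace.isOpen_generateFrom_of_mem (Or.inr ⟨d, hd.1, rfl⟩)
  refine ⟨h, @SecondCountableTopology.mk _ (CEAT Mb) ⟨_, ?_, h⟩⟩
  refine .union ((hDcount.image fun d => futIn Mb ⟨chrEmb r d, hMb.mem_point d⟩).mono ?_)
    ((hDcount.image fun d => pastIn Mb ⟨chrEmb r d, hMb.mem_point d⟩).mono ?_)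
  all_goals
    rintro S ⟨d, hd, rfl⟩
    exact ⟨d, hd, rfl⟩
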